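/- arXiv:1004.0301 — 5 statements merged into one kernel-verified Lean document; each statement's English description precedes it below -/
import Mathlib

section
/- For x ∈ ℝ² and r > 0 with |x| < r, the Bochner integral ∫_{{y : |y| ≤ r}} (x−y)/|x−y|² dy (with respect to Lebesgue measure on ℝ²) equals π·x; and if |x| > r, it equals π·r²·x/|x|². -/
open MeasureTheory Metric Set Real ComplexConjugate

/-- Outside the circle, `w ↦ (z - w)⁻¹` has the mean value property. -/
theorem circleAverage_sub_inv_of_lt_norm {z : ℂ} {ρ : ℝ} (hρ : |ρ| < ‖z‖) :
    circleAverage (fun w ↦ (z - w)⁻¹) 0 ρ = z⁻¹ := by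
  have hd : DifferentiableOn ℂ (fun w ↦ (z - w)⁻¹) (closedBall 0 |ρ|) := by
    refine DifferentiableOn.inv (by fun_prop) fun w hw h ↦ ?_
    rw [mem_closedBall_zero_iff, ← sub_eq_zero.mp h] at hw
    exact hρ.not_ge hw
  simpa using (hd.diffContOnCl_ball Subset.rfl).circleAverage

/-- The circle average of `w ↦ (z - w)⁻¹` vanishes if `z` lies inside the circle. -/
theorem circleAverage_sub_inv_of_norm_lt {z : ℂ} {ρ : ℝ} (hρ : ‖z‖ < |ρ|) :
    circleAverage (fun w ↦ (z - w)⁻¹) 0 ρ = 0 := by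
  have hpos : 0 < |ρ| := (norm_nonneg z).trans_lt hρ
  have hd : DifferentiableOn ℂ (fun w ↦ w * (conj z * w - ρ ^ 2)⁻¹) (closedBall 0 |ρ|) := by
    refine DifferentiableOn.mul (by fun_prop)
      (DifferentiableOn.inv (by fun_prop) fun w hw h ↦ ?_)
    rw [mem_closedBall_zero_iff] at hw
    have heq := congrArg norm (sub_eq_zero.mp h)
    simp only [norm_mul, RCLike.norm_conj, norm_pow, Complex.norm_real, Real.norm_eq_abs] at heq
    nlinarith [norm_nonneg z]
  have havg := (hd.diffContOnCl_ball Subset.rfl).circleAverage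
  rw [zero_mul] at havg
  have hconj : EqOn (fun w ↦ conj ((z - w)⁻¹)) (fun w ↦ w * (conj z * w - ρ ^ 2)⁻¹)
      (sphere 0 |ρ|) := by
    intro w hw
    rw [mem_sphere_zero_iff_norm] at hw
    have hw0 : w ≠ 0 := norm_pos_iff.mp (hw ▸ hpos)
    have hsq : (ρ : ℂ) ^ 2 = conj w * w := by
      rw [mul_comm, Complex.mul_conj, Complex.normSq_eq_norm_sq, hw, sq_abs]
      norm_cast
    simp only [map_inv₀, map_sub]
    rw [hsq, ← sub_mul, mul_inv, mul_left_comm, mul_inv_cancel₀ hw0, mul_one]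
  rw [← circleAverage_congr_sphere hconj] at havg
  apply (map_eq_zero (starRingEnd ℂ)).mp
  refine Eq.trans ?_ havg
  rw [circleAverage, circleAverage, Complex.real_smul, Complex.real_smul, map_mul,
    Complex.conj_ofReal, intervalIntegral.intervalIntegral_conj]

/-- The two-dimensional Coulomb kernel is integrable on disks. -/
theorem integrableOn_sub_inv_closedBall (z : ℂ) (r : ℝ) :
    IntegrableOn (fun w ↦ (z - w)⁻¹) (closedBall 0 r) := by
  have hnorm : IntegrableOn (fun w : ℂ ↦ ‖w‖⁻¹) (ball 0 (‖z‖ + r + 1)) := by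
    rw [integrableOn_fun_norm_addHaar volume (f := fun y : ℝ ↦ y⁻¹), Complex.finrank_real_complex]
    refine (integrableOn_const (C := (1 : ℝ)) (by simp)).congr_fun (fun y hy ↦ ?_)
      measurableSet_Ioo
    simp [hy.1.ne']
  have hinv : IntegrableOn (fun w : ℂ ↦ w⁻¹) (ball 0 (‖z‖ + r + 1)) :=
    hnorm.mono' (by fun_prop) (by simp)
  refine (((Measure.measurePreserving_sub_left volume z).integrableOn_comp_preimage
    (MeasurableEquiv.subLeft z).measurableEmbedding).mpr hinv).mono_set fun w hw ↦ ?_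
  rw [mem_closedBall_zero_iff] at hw
  rw [mem_preimage, mem_ball_zero_iff]
  linarith [norm_sub_le z w]

/-- Integration over a disk in polar coordinates. -/
theorem setIntegral_closedBall_eq_integral_circleAverage {E : Type*} [NormedAddCommGroup E]
    [NormedSpace ℝ E] {f : ℂ → E} {r : ℝ} (hm : StronglyMeasurable f)
    (hf : IntegrableOn f (closedBall 0 r)) :
    ∫ w in closedBall 0 r, f w = ∫ ρ in Ioc 0 r, (2 * π * ρ) • circleAverage f 0 ρ := by
  set F := (closedBall (0 : ℂ) r).indicator f with hF
  have hFm : StronglyMeasurable F := hm.indicator measurableSet_closedBall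
  have hFi : Integrable F := (integrable_indicator_iff measurableSet_closedBall).mpr hf
  have hsymm : Measurable (Complex.polarCoord.symm : ℝ × ℝ → ℂ) := by
    have : (Complex.polarCoord.symm : ℝ × ℝ → ℂ) =
        fun p ↦ p.1 * (Real.cos p.2 + Real.sin p.2 * Complex.I) :=
      funext Complex.polarCoord_symm_apply
    rw [this]
    fun_prop
  have hpolar : IntegrableOn (fun p : ℝ × ℝ ↦ p.1 • F (Complex.polarCoord.symm p))
      (Ioi 0 ×ˢ Ioo (-π) π) := by
    refine ⟨(measurable_fst.stronglyMeasurable.smul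
      (hFm.comp_measurable hsymm)).aestronglyMeasurable, ?_⟩
    have := hFi.2
    rw [HasFiniteIntegral, ← Complex.lintegral_comp_polarCoord_symm] at this
    refine lt_of_eq_of_lt ?_ this
    refine setLIntegral_congr_fun (measurableSet_Ioi.prod measurableSet_Ioo) fun p hp ↦ ?_
    simp only [enorm_smul, smul_eq_mul, Real.enorm_of_nonneg (le_of_lt hp.1)]
  have hcirc (ρ θ : ℝ) : Complex.polarCoord.symm (ρ, θ) = circleMap 0 ρ θ := by
    simp [circleMap, Complex.exp_mul_I]
  rw [← integral_indicator measurableSet_closedBall, ← Complex.integral_comp_polarCoord_symm,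
    polarCoord_target, Measure.volume_eq_prod, setIntegral_prod _ hpolar,
    ← Ioi_inter_Iic, ← setIntegral_indicator measurableSet_Iic]
  refine setIntegral_congr_fun measurableSet_Ioi fun ρ hρ ↦ ?_
  have hρ : 0 < ρ := hρ
  simp only [hcirc, integral_smul]
  by_cases h : ρ ≤ r
  · have hmem (θ : ℝ) : circleMap 0 ρ θ ∈ closedBall (0 : ℂ) r := by
      simpa [abs_of_pos hρ] using h
    simp only [indicator_of_mem (mem_Iic.mpr h), hF, indicator_of_mem (hmem _)]
    rw [circleAverage_eq_integral_add (-π), intervalIntegral.integral_comp_add_right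
      (fun θ ↦ f (circleMap 0 ρ θ)), intervalIntegral.integral_of_le (by linarith [pi_pos]),
      smul_smul, ← integral_Ioc_eq_integral_Ioo]
    congr 2
    · field_simp
    · congr 2 <;> ring
  · have hmem (θ : ℝ) : circleMap 0 ρ θ ∉ closedBall (0 : ℂ) r := by
      simpa [abs_of_pos hρ] using h
    simp [indicator_of_notMem (mem_Iic.not.mpr h), hF, indicator_of_notMem (hmem _)]

/-- The complex Cauchy transform of the uniform measure on a disk. -/
theorem setIntegral_closedBall_sub_inv (z : ℂ) {r : ℝ} (hr : 0 ≤ r) :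
    ∫ w in closedBall 0 r, (z - w)⁻¹ = π * (min r ‖z‖ : ℝ) ^ 2 * z⁻¹ := by
  rw [setIntegral_closedBall_eq_integral_circleAverage
    (Measurable.stronglyMeasurable (by fun_prop)) (integrableOn_sub_inv_closedBall z r)]
  have hae : ∀ᵐ ρ : ℝ, ρ ∈ Ioc 0 r →
      (2 * π * ρ) • circleAverage (fun w ↦ (z - w)⁻¹) 0 ρ =
        (Iic ‖z‖).indicator (fun ρ : ℝ ↦ (2 * π * ρ) • z⁻¹) ρ := by
    filter_upwards [Measure.ae_ne volume ‖z‖] with ρ hne hρ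
    rcases lt_or_gt_of_ne hne with h | h
    · rw [circleAverage_sub_inv_of_lt_norm (by rwa [abs_of_pos hρ.1]),
        indicator_of_mem (mem_Iic.mpr h.le)]
    · rw [circleAverage_sub_inv_of_norm_lt (by rwa [abs_of_pos hρ.1]),
        indicator_of_notMem (by simpa using h), smul_zero]
  rw [setIntegral_congr_ae measurableSet_Ioc hae, setIntegral_indicator measurableSet_Iic,
    Ioc_inter_Iic, ← intervalIntegral.integral_of_le (le_min hr (norm_nonneg z)),
    intervalIntegral.integral_smul_const, intervalIntegral.integral_const_mul, integral_id,
    Complex.real_smul]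
  push_cast
  ring

/-- **Newton's theorem** for a uniformly charged disk in the plane. -/
theorem setIntegral_closedBall_coulomb (x : EuclideanSpace ℝ (Fin 2)) {r : ℝ} (hr : 0 ≤ r) :
    ∫ y in closedBall (0 : EuclideanSpace ℝ (Fin 2)) r, (‖x - y‖ ^ 2)⁻¹ • (x - y) =
      (π * min r ‖x‖ ^ 2 / ‖x‖ ^ 2) • x := by
  let e := Complex.orthonormalBasisOneI.repr
  have hinv (z : ℂ) : (‖z‖ ^ 2)⁻¹ • z = conj z⁻¹ := by
    rw [Complex.inv_def, map_mul, Complex.conj_conj, Complex.conj_ofReal,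
      Complex.normSq_eq_norm_sq, Complex.real_smul, mul_comm]
  obtain ⟨z, rfl⟩ := e.surjective x
  have hpre : e ⁻¹' closedBall 0 r = closedBall 0 r := by simp
  rw [← e.measurePreserving.setIntegral_preimage_emb
    e.toMeasurableEquiv.measurableEmbedding, hpre]
  simp only [← map_sub, e.norm_map, ← map_smul]
  have hcomm := e.toContinuousLinearEquiv.integral_comp_comm
    (μ := volume.restrict (closedBall (0 : ℂ) r)) fun w ↦ (‖z - w‖ ^ 2)⁻¹ • (z - w)
  refine hcomm.trans (congrArg e ?_)
  simp only [hinv]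
  rw [integral_conj, setIntegral_closedBall_sub_inv z hr, map_mul, ← hinv, mul_div_assoc,
    div_eq_mul_inv, ← mul_assoc, mul_smul]
  rw [Complex.real_smul (x := π * _)]
  simp

/-- The two-dimensional Newton theorem for a uniformly charged disk: for `x ∈ ℝ²` and `r > 0`,
`∫_{|y| ≤ r} (x−y)/|x−y|² dy = π·x` if `|x| < r`, and `= π·r²·x/|x|²` if `|x| > r`. -/
theorem newton_disk (x : EuclideanSpace ℝ (Fin 2)) (r : ℝ) (hr : 0 < r) :
    (‖x‖ < r →
      ∫ y in Metric.closedBall (0 : EuclideanSpace ℝ (Fin 2)) r,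
        (‖x - y‖^2)⁻¹ • (x - y) = Real.pi • x) ∧
    (r < ‖x‖ →
      ∫ y in Metric.closedBall (0 : EuclideanSpace ℝ (Fin 2)) r,
        (‖x - y‖^2)⁻¹ • (x - y) = (Real.pi * r^2 / ‖x‖^2) • x) := by
  rw [setIntegral_closedBall_coulomb x hr.le]
  refine ⟨fun h ↦ ?_, fun h ↦ by rw [min_eq_left h.le]⟩
  rcases eq_or_ne x 0 with rfl | hx
  · simp
  · rw [min_eq_right h.le, mul_div_cancel_right₀ _ (pow_ne_zero 2 (norm_ne_zero_iff.mpr hx))]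
end

section
/- For every x ∈ ℝ², the limit lim_{r→∞} ∫_{{y : |y| < r}} ((x−y)/|x−y|²)·π⁻¹·(1 − exp(−|x−y|²)) dy exists as a Bochner integral with respect to Lebesgue measure on ℝ² and equals x. -/
open MeasureTheory Filter

/-- Reflection through `x / 2` exchanges the balls of radius `r` centered at `0` and at `x`. -/
lemma setIntegral_ball_comp_sub_left {F : Type*} [NormedAddCommGroup F] [NormedSpace ℝ F]
    (x : EuclideanSpace ℝ (Fin 2)) (r : ℝ) (f : EuclideanSpace ℝ (Fin 2) → F) :
    ∫ y in Metric.ball (0 : EuclideanSpace ℝ (Fin 2)) r, f (x - y) =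
      ∫ z in Metric.ball x r, f z := by
  have h := (Measure.measurePreserving_sub_left
    (volume : Measure (EuclideanSpace ℝ (Fin 2))) x).setIntegral_preimage_emb
    (MeasurableEquiv.subLeft x).measurableEmbedding f (Metric.ball x r)
  rw [← h]
  congr 2
  ext y
  simp [dist_eq_norm]

lemma setIntegral_ball_eq_zero_of_odd {F : Type*} [NormedAddCommGroup F] [NormedSpace ℝ F]
    (r : ℝ) (f : EuclideanSpace ℝ (Fin 2) → F) (hf : ∀ z, f (-z) = -f z) :
    ∫ z in Metric.ball (0 : EuclideanSpace ℝ (Fin 2)) r, f z = 0 := by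
  have h := setIntegral_ball_comp_sub_left 0 r f
  simp only [zero_sub, hf, integral_neg] at h
  have h2 : (2 : ℝ) • ∫ z in Metric.ball (0 : EuclideanSpace ℝ (Fin 2)) r, f z = 0 := by
    rw [two_smul]
    nth_rewrite 1 [← h]
    exact neg_add_cancel _
  exact (smul_eq_zero.mp h2).resolve_left two_ne_zero

lemma measureReal_ball_fin_two (x : EuclideanSpace ℝ (Fin 2)) {r : ℝ} (hr : 0 ≤ r) :
    volume.real (Metric.ball x r) = r ^ 2 * Real.pi := by
  rw [Measure.real, EuclideanSpace.volume_ball_fin_two]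
  simp [ENNReal.toReal_mul, ENNReal.toReal_pow, ENNReal.toReal_ofReal hr, Real.pi_nonneg]

lemma integrableOn_id_ball (x : EuclideanSpace ℝ (Fin 2)) (r : ℝ) :
    IntegrableOn (fun z : EuclideanSpace ℝ (Fin 2) => z) (Metric.ball x r) :=
  (continuous_id.locallyIntegrable.integrableOn_isCompact
    (isCompact_closedBall x r)).mono_set Metric.ball_subset_closedBall

lemma setIntegral_id_ball (x : EuclideanSpace ℝ (Fin 2)) {r : ℝ} (hr : 0 ≤ r) :
    ∫ z in Metric.ball x r, z = (r ^ 2 * Real.pi) • x := by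
  rw [← setIntegral_ball_comp_sub_left x r (fun z => z),
    integral_sub (integrableOn_const measure_ball_lt_top.ne).integrable
      (integrableOn_id_ball 0 r).integrable,
    setIntegral_ball_eq_zero_of_odd r (fun z => z) (fun _ => rfl), setIntegral_const,
    measureReal_ball_fin_two 0 hr, sub_zero]

/-- The Coulomb field weighted by the one-point density of the Ginibre Palm measure. -/
noncomputable def ginibreField (z : EuclideanSpace ℝ (Fin 2)) : EuclideanSpace ℝ (Fin 2) :=
  (Real.pi⁻¹ * (1 - Real.exp (-‖z‖ ^ 2)) / ‖z‖ ^ 2) • z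

lemma ginibreField_neg (z : EuclideanSpace ℝ (Fin 2)) :
    ginibreField (-z) = -ginibreField z := by
  simp [ginibreField]

lemma norm_ginibreField_le (z : EuclideanSpace ℝ (Fin 2)) :
    ‖ginibreField z‖ ≤ Real.pi⁻¹ * ‖z‖ := by
  have h1 : 0 ≤ 1 - Real.exp (-‖z‖ ^ 2) := by
    have : Real.exp (-‖z‖ ^ 2) ≤ 1 := Real.exp_le_one_iff.mpr (by nlinarith [sq_nonneg ‖z‖])
    linarith
  have h2 : 1 - Real.exp (-‖z‖ ^ 2) ≤ ‖z‖ ^ 2 := by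
    linarith [Real.add_one_le_exp (-‖z‖ ^ 2)]
  have hpi : 0 ≤ Real.pi⁻¹ := by positivity
  rw [ginibreField, norm_smul, Real.norm_eq_abs, abs_of_nonneg (by positivity), mul_div_assoc]
  gcongr
  exact mul_le_of_le_one_right hpi (div_le_one_of_le₀ h2 (by positivity))

lemma integrableOn_ginibreField (x : EuclideanSpace ℝ (Fin 2)) (r : ℝ) :
    IntegrableOn ginibreField (Metric.ball x r) := by
  refine Integrable.mono' ((integrableOn_id_ball x r).norm.const_mul Real.pi⁻¹) ?_
    (ae_of_all _ norm_ginibreField_le)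
  have : Measurable ginibreField := by unfold ginibreField; fun_prop
  exact this.aestronglyMeasurable

/-- On an annulus of bounded width around the circle of radius `r`, the field is close to
the linear field `z / (π r²)`. -/
lemma norm_ginibreField_sub_le {c r : ℝ} (hc : 0 ≤ c) (hr1 : 1 ≤ r) (hr : 2 * c ≤ r)
    {z : EuclideanSpace ℝ (Fin 2)} (hz1 : r - c ≤ ‖z‖) (hz2 : ‖z‖ ≤ r + c) :
    ‖ginibreField z - (Real.pi⁻¹ / r ^ 2) • z‖ ≤ Real.pi⁻¹ * ((8 + 6 * c) / r ^ 2) := by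
  set s := ‖z‖ with hs
  have hsr : r / 2 ≤ s := by linarith
  have hs0 : 0 < s := by linarith
  have hr0 : 0 < r := by linarith
  have hexp : Real.exp (-s ^ 2) ≤ 1 / s ^ 2 := by
    rw [Real.exp_neg, ← one_div]
    exact one_div_le_one_div_of_le (by positivity) (by linarith [Real.add_one_le_exp (s ^ 2)])
  have hfirst : Real.exp (-s ^ 2) / s ≤ 8 / r ^ 2 := by
    calc Real.exp (-s ^ 2) / s ≤ (1 / s ^ 2) / s := by gcongr
      _ = 1 / s ^ 3 := by field_simp
      _ ≤ 1 / (r / 2) ^ 3 := by gcongr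
      _ = 8 / r ^ 2 / r := by field_simp; norm_num
      _ ≤ 8 / r ^ 2 := div_le_self (by positivity) hr1
  have habs : |r ^ 2 - s ^ 2| ≤ 3 * c * r := by
    rw [abs_le]; constructor <;> nlinarith
  have hsecond : |r ^ 2 - s ^ 2| / (r ^ 2 * s) ≤ 6 * c / r ^ 2 := by
    calc |r ^ 2 - s ^ 2| / (r ^ 2 * s) ≤ (3 * c * r) / (r ^ 2 * (r / 2)) := by gcongr
      _ = 6 * c / r ^ 2 := by field_simp; ring
  have heq : ginibreField z - (Real.pi⁻¹ / r ^ 2) • z =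
      (Real.pi⁻¹ * ((r ^ 2 - s ^ 2) / (r ^ 2 * s) - Real.exp (-s ^ 2) / s) / s) • z := by
    rw [ginibreField, ← sub_smul, ← hs]
    congr 1
    field_simp
    ring
  rw [heq, norm_smul, ← hs, Real.norm_eq_abs, abs_div, abs_of_pos hs0, div_mul_cancel₀ _ hs0.ne',
    abs_mul, abs_of_pos (inv_pos.mpr Real.pi_pos)]
  gcongr
  calc |(r ^ 2 - s ^ 2) / (r ^ 2 * s) - Real.exp (-s ^ 2) / s|
      ≤ |(r ^ 2 - s ^ 2) / (r ^ 2 * s)| + |Real.exp (-s ^ 2) / s| := abs_sub _ _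
    _ = |r ^ 2 - s ^ 2| / (r ^ 2 * s) + Real.exp (-s ^ 2) / s := by
      rw [abs_div, abs_of_pos (by positivity : 0 < r ^ 2 * s),
        abs_of_pos (by positivity : 0 < Real.exp (-s ^ 2) / s)]
    _ ≤ 6 * c / r ^ 2 + 8 / r ^ 2 := add_le_add hsecond hfirst
    _ = (8 + 6 * c) / r ^ 2 := by ring

lemma norm_setIntegral_ginibreField_sub_le (x : EuclideanSpace ℝ (Fin 2)) {r : ℝ}
    (hr1 : 1 ≤ r) (hr : 2 * ‖x‖ ≤ r) :
    ‖(∫ z in Metric.ball x r, ginibreField z) - x‖ ≤ (8 + 6 * ‖x‖) * (2 * ‖x‖) / r := by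
  have hc : 0 ≤ ‖x‖ := norm_nonneg x
  have hr0 : 0 < r := by linarith
  have hlin (w : EuclideanSpace ℝ (Fin 2)) (ρ : ℝ) : IntegrableOn
      (fun z : EuclideanSpace ℝ (Fin 2) => (Real.pi⁻¹ / r ^ 2) • z) (Metric.ball w ρ) :=
    Integrable.smul (Real.pi⁻¹ / r ^ 2) (integrableOn_id_ball w ρ)
  have hsub : Metric.ball (0 : EuclideanSpace ℝ (Fin 2)) (r - ‖x‖) ⊆ Metric.ball x r :=
    Metric.ball_subset_ball' (by simp)
  have hx : (∫ z in Metric.ball x r, (Real.pi⁻¹ / r ^ 2) • z) = x := by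
    rw [integral_smul, setIntegral_id_ball x hr0.le, smul_smul]
    convert one_smul ℝ x
    field_simp
  have hzero : ∫ z in Metric.ball (0 : EuclideanSpace ℝ (Fin 2)) (r - ‖x‖),
      (ginibreField z - (Real.pi⁻¹ / r ^ 2) • z) = 0 :=
    setIntegral_ball_eq_zero_of_odd _ _ fun z => by rw [ginibreField_neg, smul_neg]; abel
  have hdiff : (∫ z in Metric.ball x r, ginibreField z) - x =
      ∫ z in Metric.ball x r \ Metric.ball 0 (r - ‖x‖),
        (ginibreField z - (Real.pi⁻¹ / r ^ 2) • z) := by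
    rw [setIntegral_sdiff (f := fun z => ginibreField z - (Real.pi⁻¹ / r ^ 2) • z)
      measurableSet_ball ((integrableOn_ginibreField x r).sub (hlin x r)) hsub, hzero, sub_zero,
      integral_sub (integrableOn_ginibreField x r) (hlin x r), hx]
  have hvol : volume.real (Metric.ball x r \ Metric.ball 0 (r - ‖x‖)) ≤
      Real.pi * (2 * ‖x‖ * r) := by
    rw [measureReal_sdiff hsub measurableSet_ball, measureReal_ball_fin_two x hr0.le,
      measureReal_ball_fin_two 0 (by linarith)]
    nlinarith [mul_nonneg Real.pi_nonneg (sq_nonneg ‖x‖)]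
  rw [hdiff]
  calc _ ≤ Real.pi⁻¹ * ((8 + 6 * ‖x‖) / r ^ 2) *
        volume.real (Metric.ball x r \ Metric.ball 0 (r - ‖x‖)) := by
        refine norm_setIntegral_le_of_norm_le_const
          ((measure_mono Set.sdiff_subset).trans_lt measure_ball_lt_top) fun z hz => ?_
        refine norm_ginibreField_sub_le hc hr1 hr (by simpa using hz.2) ?_
        have hzx : ‖z - x‖ < r := by simpa [dist_eq_norm] using hz.1
        linarith [norm_le_norm_sub_add z x]
    _ ≤ Real.pi⁻¹ * ((8 + 6 * ‖x‖) / r ^ 2) * (Real.pi * (2 * ‖x‖ * r)) := by gcongr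
    _ = (8 + 6 * ‖x‖) * (2 * ‖x‖) / r := by field_simp

/-- For every `x ∈ ℝ²`, the limit over balls centered at the origin
`lim_{r→∞} ∫_{|y| < r} ((x−y)/|x−y|²)·π⁻¹·(1 − exp(−|x−y|²)) dy` exists and equals `x`. -/
theorem ginibre_drift_discrepancy (x : EuclideanSpace ℝ (Fin 2)) :
    Tendsto (fun r : ℝ =>
        ∫ y in Metric.ball (0 : EuclideanSpace ℝ (Fin 2)) r,
          ((Real.pi)⁻¹ * (1 - Real.exp (-‖x - y‖^2)) / ‖x - y‖^2) • (x - y))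
      atTop (nhds x) := by
  change Tendsto (fun r : ℝ => ∫ y in Metric.ball (0 : EuclideanSpace ℝ (Fin 2)) r,
    ginibreField (x - y)) atTop (nhds x)
  simp only [setIntegral_ball_comp_sub_left]
  rw [tendsto_iff_norm_sub_tendsto_zero]
  refine squeeze_zero' (Eventually.of_forall fun _ => norm_nonneg _) ?_
    (tendsto_id.const_div_atTop ((8 + 6 * ‖x‖) * (2 * ‖x‖)))
  filter_upwards [eventually_ge_atTop 1, eventually_ge_atTop (2 * ‖x‖)] with r hr1 hr
  exact norm_setIntegral_ginibreField_sub_le x hr1 hr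
end

section
/- For every x ∈ ℝ² and every r > 0, the Bochner integral ∫_{{y : 0 < |y−x| < r}} ((x−y)/|x−y|²)·π⁻¹·(1 − exp(−|x−y|²)) dy with respect to Lebesgue measure on ℝ² converges absolutely and equals 0. -/
open MeasureTheory

/-- A set integral vanishes when the set is symmetric and the integrand odd under the point
reflection `y ↦ x + x - y`. -/
theorem setIntegral_eq_zero_of_antipodal {G E : Type*} [AddCommGroup G] [MeasurableSpace G]
    [MeasurableAdd G] [MeasurableNeg G] {μ : Measure G} [μ.IsAddLeftInvariant]
    [μ.IsNegInvariant] [NormedAddCommGroup E] [NormedSpace ℝ E] {s : Set G}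
    (hs : MeasurableSet s) {f : G → E} (x : G) (hsymm : ∀ y, x + x - y ∈ s ↔ y ∈ s)
    (hodd : ∀ y, f (x + x - y) = -f y) : ∫ y in s, f y ∂μ = 0 := by
  rw [← integral_indicator hs]
  have : IsAddTorsionFree E := .of_isTorsionFree ℝ E
  refine self_eq_neg.1 ?_
  rw [← integral_neg]
  conv_lhs => rw [← integral_sub_left_eq_self (s.indicator f) μ (x + x)]
  refine integral_congr_ae (.of_forall fun y => ?_)
  by_cases hy : y ∈ s <;> simp [Set.indicator, hsymm, hodd, hy]

theorem norm_one_sub_exp_neg_div_le_one {t : ℝ} (ht : 0 ≤ t) :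
    ‖(1 - Real.exp (-t)) / t‖ ≤ 1 := by
  have hexp : Real.exp (-t) ≤ 1 := Real.exp_le_one_iff.2 (neg_nonpos.2 ht)
  rw [Real.norm_of_nonneg (div_nonneg (sub_nonneg.2 hexp) ht)]
  exact div_le_one_of_le₀ (by linarith [Real.add_one_le_exp (-t)]) ht

/-- For every `x ∈ ℝ²` and `r > 0`, the Bochner integral over the punctured ball centered
at `x` of the Coulomb field against the Palm density,
`∫_{0 < |y−x| < r} ((x−y)/|x−y|²)·π⁻¹·(1 − exp(−|x−y|²)) dy`,
converges absolutely and equals `0`. -/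
theorem ginibre_palm_drift_centered (x : EuclideanSpace ℝ (Fin 2)) (r : ℝ) (hr : 0 < r) :
    IntegrableOn (fun y : EuclideanSpace ℝ (Fin 2) =>
        ((Real.pi)⁻¹ * (1 - Real.exp (-‖x - y‖^2)) / ‖x - y‖^2) • (x - y))
      {y | 0 < ‖y - x‖ ∧ ‖y - x‖ < r} volume ∧
    ∫ y in {y : EuclideanSpace ℝ (Fin 2) | 0 < ‖y - x‖ ∧ ‖y - x‖ < r},
        ((Real.pi)⁻¹ * (1 - Real.exp (-‖x - y‖^2)) / ‖x - y‖^2) • (x - y) = 0 := by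
  have hS : MeasurableSet {y : EuclideanSpace ℝ (Fin 2) | 0 < ‖y - x‖ ∧ ‖y - x‖ < r} := by
    measurability
  refine ⟨?_, setIntegral_eq_zero_of_antipodal hS x (fun y => ?_) fun y => ?_⟩
  · refine Measure.integrableOn_of_bounded (M := Real.pi⁻¹ * r) ?_ ?_ ?_
    · refine measure_ne_top_of_subset (fun y hy => ?_)
        (measure_ball_lt_top (μ := volume) (x := x) (r := r)).ne
      simpa [dist_eq_norm] using hy.2
    · exact Measurable.aestronglyMeasurable (by fun_prop)
    · filter_upwards [ae_restrict_mem hS] with y hy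
      rw [norm_smul, mul_div_assoc, norm_mul, Real.norm_of_nonneg (inv_nonneg.2 Real.pi_pos.le),
        mul_assoc]
      have hxy : ‖x - y‖ ≤ r := (norm_sub_rev x y).trans_le hy.2.le
      gcongr
      exact (mul_le_of_le_one_left (norm_nonneg _)
        (norm_one_sub_exp_neg_div_le_one (sq_nonneg _))).trans hxy
  · rw [Set.mem_ofPred_eq, Set.mem_ofPred_eq, show x + x - y - x = x - y by abel, norm_sub_rev x y]
  · rw [show x - (x + x - y) = -(x - y) by abel, norm_neg, smul_neg]
end

section
/- For all x, y ∈ ℝ, ∫_ℝ S(x,z)·S(z,y) dz = S(x,y), where the integral is with respect to Lebesgue measure on ℝ; i.e., the sine kernel is a reproducing (projection) kernel. -/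
open MeasureTheory

/-- The sine kernel `S(x,y) = sin(π(x−y))/(π(x−y))` for `x ≠ y`, with `S(x,x) = 1`. -/
noncomputable def sineK (x y : ℝ) : ℝ :=
  if x = y then 1 else Real.sin (Real.pi * (x - y)) / (Real.pi * (x - y))

open Set FourierTransform Convolution Topology

theorem sineK_eq_sinc (x y : ℝ) : sineK x y = Real.sinc (Real.pi * (x - y)) := by
  simp [sineK, Real.sinc, sub_eq_zero, Real.pi_ne_zero]

theorem sineK_comm (x y : ℝ) : sineK x y = sineK y x := by
  rw [sineK_eq_sinc, sineK_eq_sinc, ← Real.sinc_neg]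
  congr 1
  ring

theorem continuous_sineK (x : ℝ) : Continuous (sineK x) := by
  simp_rw [funext (sineK_eq_sinc x)]
  exact Real.continuous_sinc.comp (by fun_prop)

theorem sinc_sq_le (u : ℝ) : Real.sinc u ^ 2 ≤ 2 * (1 + u ^ 2)⁻¹ := by
  rw [← div_eq_mul_inv, le_div_iff₀ (by positivity)]
  have h₁ : Real.sinc u ^ 2 ≤ 1 := (sq_le_one_iff_abs_le_one _).2 (Real.abs_sinc_le_one u)
  have h₂ : (Real.sinc u * u) ^ 2 ≤ 1 := by
    rcases eq_or_ne u 0 with rfl | hu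
    · simp
    · rw [Real.sinc_of_ne_zero hu, div_mul_cancel₀ _ hu]
      exact Real.sin_sq_le_one u
  nlinarith

theorem memLp_two_sineK (x : ℝ) : MemLp (sineK x) 2 := by
  rw [memLp_two_iff_integrable_sq (continuous_sineK x).aestronglyMeasurable]
  have hI : Integrable fun z : ℝ => 2 * (1 + (Real.pi * (x - z)) ^ 2)⁻¹ :=
    ((integrable_inv_one_add_sq.comp_mul_left' Real.pi_ne_zero).comp_sub_left x).const_mul 2
  refine hI.mono' ((continuous_sineK x).pow 2).aestronglyMeasurable (.of_forall fun z => ?_)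
  rw [Real.norm_of_nonneg (sq_nonneg _), sineK_eq_sinc]
  exact sinc_sq_le _

/-- The pure wave of frequency `x` restricted to the unit band `[-1/2, 1/2]`. -/
noncomputable def bandWave (x : ℝ) : ℝ → ℂ :=
  (Icc (-(1 / 2)) (1 / 2)).indicator fun t : ℝ => Complex.exp (2 * Real.pi * x * Complex.I * t)

theorem integrable_bandWave (x : ℝ) : Integrable (bandWave x) := by
  rw [bandWave, integrable_indicator_iff measurableSet_Icc]
  exact (Continuous.continuousOn (by fun_prop)).integrableOn_Icc

theorem norm_bandWave_le_one (x t : ℝ) : ‖bandWave x t‖ ≤ 1 := by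
  refine (norm_indicator_le_norm_self _ _).trans (le_of_eq ?_)
  convert! Complex.norm_exp_ofReal_mul_I (2 * Real.pi * x * t) using 3
  push_cast
  ring

theorem bandWave_neg (x t : ℝ) : bandWave x (-t) = bandWave (-x) t := by
  have h : -t ∈ Icc (-(1 / 2) : ℝ) (1 / 2) ↔ t ∈ Icc (-(1 / 2) : ℝ) (1 / 2) := by
    simp only [mem_Icc]
    constructor <;> rintro ⟨_, _⟩ <;> constructor <;> linarith
  simp only [bandWave, indicator_apply, h]
  push_cast
  ring_nf

theorem bandWave_mul (x y t : ℝ) : bandWave x t * bandWave y t = bandWave (x + y) t := by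
  by_cases ht : t ∈ Icc (-(1 / 2) : ℝ) (1 / 2)
  · simp only [bandWave, indicator_of_mem ht, ← Complex.exp_add]
    push_cast
    ring_nf
  · simp only [bandWave, indicator_of_notMem ht, mul_zero]

theorem continuousAt_bandWave (x : ℝ) {t : ℝ} (h₁ : t ≠ -(1 / 2)) (h₂ : t ≠ 1 / 2) :
    ContinuousAt (bandWave x) t := by
  refine ContinuousOn.continuousAt_indicator (Continuous.continuousOn (by fun_prop)) ?_
  rw [frontier_Icc (by norm_num)]
  exact fun h => h.elim h₁ h₂

theorem integral_bandWave_sub (x y : ℝ) : ∫ t, bandWave (x - y) t = sineK x y := by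
  rw [bandWave, integral_indicator measurableSet_Icc, integral_Icc_eq_integral_Ioc,
    ← intervalIntegral.integral_of_le (by norm_num), sineK]
  split_ifs with h
  · simp [h]
    norm_num
  · have hπ : (Real.pi : ℂ) ≠ 0 := by exact_mod_cast Real.pi_ne_zero
    have hxy : (x : ℂ) - y ≠ 0 := by exact_mod_cast sub_ne_zero.2 h
    have hc : 2 * Real.pi * ((x - y : ℝ) : ℂ) * Complex.I ≠ 0 := by
      push_cast
      simp [hπ, hxy]
    rw [integral_exp_mul_complex hc]
    push_cast
    rw [Complex.sin]
    have e₁ : 2 * Real.pi * ((x : ℂ) - y) * Complex.I * (1 / 2)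
      = Real.pi * (x - y) * Complex.I := by ring
    have e₂ : 2 * Real.pi * ((x : ℂ) - y) * Complex.I * -(1 / 2)
      = -(Real.pi * (x - y)) * Complex.I := by ring
    rw [e₁, e₂]
    field_simp
    rw [Complex.I_sq]
    ring

theorem fourier_bandWave (x z : ℝ) : 𝓕 (bandWave x) z = sineK x z := by
  rw [← integral_bandWave_sub, Real.fourier_real_eq_integral_exp_smul]
  congr 1 with t
  simp only [bandWave, indicator_apply, smul_eq_mul]
  split_ifs
  · rw [← Complex.exp_add]
    push_cast
    ring_nf
  · simp

theorem bandWave_convolution_zero (x y : ℝ) :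
    (bandWave x ⋆[ContinuousLinearMap.mul ℂ ℂ] bandWave y) 0 = sineK x y := by
  rw [convolution_def, ← integral_bandWave_sub]
  simp [bandWave_neg, bandWave_mul, sub_eq_add_neg]

theorem continuousAt_bandWave_convolution_zero (x y : ℝ) :
    ContinuousAt (bandWave x ⋆[ContinuousLinearMap.mul ℂ ℂ] bandWave y) 0 := by
  refine continuousAt_of_dominated (bound := fun t => ‖bandWave x t‖) ?_ ?_
    (integrable_bandWave x).norm ?_
  · exact .of_forall fun s => (integrable_bandWave x).aestronglyMeasurable.mul
      ((integrable_bandWave y).comp_sub_left s).aestronglyMeasurable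
  · refine .of_forall fun s => .of_forall fun t => ?_
    rw [ContinuousLinearMap.mul_apply', norm_mul]
    exact mul_le_of_le_one_right (norm_nonneg _) (norm_bandWave_le_one y _)
  · filter_upwards [Measure.ae_ne volume (1 / 2 : ℝ), Measure.ae_ne volume (-(1 / 2) : ℝ)]
      with t h₁ h₂
    have hc : ContinuousAt (bandWave y) (0 - t) :=
      continuousAt_bandWave y (fun h => h₁ (by linarith)) (fun h => h₂ (by linarith))
    exact continuousAt_const.mul
      (ContinuousAt.comp (f := fun s : ℝ => s - t) hc (by fun_prop))

/-- The sine kernel is a reproducing (projection) kernel: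
`∫_ℝ S(x,z)·S(z,y) dz = S(x,y)` with respect to Lebesgue measure on `ℝ`. -/
theorem sine_kernel_reproducing (x y : ℝ) :
    Integrable (fun z : ℝ => sineK x z * sineK z y) volume ∧
    ∫ z : ℝ, sineK x z * sineK z y = sineK x y := by
  have hint : Integrable fun z : ℝ => sineK x z * sineK z y := by
    simp_rw [fun z => sineK_comm z y]
    exact (memLp_two_sineK x).integrable_mul (memLp_two_sineK y)
  refine ⟨hint, ?_⟩
  set F := bandWave x ⋆[ContinuousLinearMap.mul ℂ ℂ] bandWave y with hF
  have hfourier : 𝓕 F = fun z => ((sineK x z * sineK z y : ℝ) : ℂ) := by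
    ext z
    rw [hF, Real.fourier_mul_convolution_eq (integrable_bandWave x) (integrable_bandWave y),
      fourier_bandWave, fourier_bandWave, sineK_comm z y]
    push_cast
    rfl
  have hinv := ((integrable_bandWave x).integrable_convolution (ContinuousLinearMap.mul ℂ ℂ)
    (integrable_bandWave y)).fourierInv_fourier_eq (by rw [← hF, hfourier]; exact hint.ofReal)
    (continuousAt_bandWave_convolution_zero x y)
  rw [← hF, hfourier, Real.fourierInv_eq, hF, bandWave_convolution_zero] at hinv
  simp only [inner_zero_right, AddChar.map_zero_eq_one, one_smul, integral_complex_ofReal] at hinv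
  exact_mod_cast hinv
end

section
/- For every n ≥ 1 and all x₁, …, xₙ ∈ ℝ, one has 0 ≤ det[S(x_i, x_j)]_{1≤i,j≤n} ≤ 1. -/
open Matrix

theorem sineK_eq_integral (x y : ℝ) :
    sineK x y = ∫ t in (0 : ℝ)..1, Real.cos (Real.pi * (x - y) * t) := by
  unfold sineK
  split_ifs with h
  · simp [h]
  · have hd : Real.pi * (x - y) ≠ 0 := mul_ne_zero Real.pi_ne_zero (sub_ne_zero.mpr h)
    rw [intervalIntegral.integral_comp_mul_left Real.cos hd, integral_cos]
    simp [div_eq_inv_mul]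

theorem sum_mul_cos_sub {ι : Type*} [Fintype ι] (c a : ι → ℝ) :
    ∑ i, ∑ j, c i * c j * Real.cos (a i - a j) =
      (∑ i, c i * Real.cos (a i)) ^ 2 + (∑ i, c i * Real.sin (a i)) ^ 2 := by
  simp only [sq, Finset.sum_mul_sum, ← Finset.sum_add_distrib]
  refine Finset.sum_congr rfl fun i _ => Finset.sum_congr rfl fun j _ => ?_
  rw [Real.cos_sub]
  ring

theorem sineK_posSemidef {ι : Type*} [Fintype ι] (x : ι → ℝ) :
    (Matrix.of fun i j => sineK (x i) (x j)).PosSemidef := by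
  refine PosSemidef.of_dotProduct_mulVec_nonneg ?_ fun c => ?_
  · ext i j
    have h : ∀ t, Real.pi * (x j - x i) * t = -(Real.pi * (x i - x j) * t) := fun t => by ring
    simp [sineK_eq_integral, h, Real.cos_neg]
  · have hform : star c ⬝ᵥ ((Matrix.of fun i j => sineK (x i) (x j)) *ᵥ c) =
        ∫ t in (0 : ℝ)..1, ∑ i, ∑ j,
          c i * c j * Real.cos (Real.pi * x i * t - Real.pi * x j * t) := by
      rw [intervalIntegral.integral_finsetSum
        fun i _ => Continuous.intervalIntegrable (by fun_prop) _ _]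
      refine Finset.sum_congr rfl fun i _ => ?_
      rw [intervalIntegral.integral_finsetSum
        fun j _ => Continuous.intervalIntegrable (by fun_prop) _ _]
      simp only [mulVec, dotProduct, Finset.mul_sum]
      refine Finset.sum_congr rfl fun j _ => ?_
      rw [intervalIntegral.integral_const_mul]
      simp only [← sub_mul, ← mul_sub, ← sineK_eq_integral, of_apply, Pi.star_apply, star_trivial]
      ring
    rw [hform]
    refine intervalIntegral.integral_nonneg zero_le_one fun t _ => ?_
    rw [sum_mul_cos_sub]
    positivity

theorem Matrix.PosSemidef.det_le_exp_trace_sub_card {ι : Type*} [Fintype ι] [DecidableEq ι]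
    {A : Matrix ι ι ℝ} (hA : A.PosSemidef) :
    A.det ≤ Real.exp (A.trace - Fintype.card ι) := by
  calc A.det = ∏ i, hA.isHermitian.eigenvalues i := by
        simpa using hA.isHermitian.det_eq_prod_eigenvalues
    _ ≤ ∏ i, Real.exp (hA.isHermitian.eigenvalues i - 1) := by
        refine Finset.prod_le_prod (fun i _ => hA.eigenvalues_nonneg i) fun i _ => ?_
        linarith [Real.add_one_le_exp (hA.isHermitian.eigenvalues i - 1)]
    _ = Real.exp (A.trace - Fintype.card ι) := by
        rw [← Real.exp_sum, hA.isHermitian.trace_eq_sum_eigenvalues]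
        simp

/-- The `n`-point correlation functions of Dyson's random point field (β = 2) satisfy
`0 ≤ det[S(x_i, x_j)] ≤ 1`. -/
theorem sine_correlation_bound (n : ℕ) (hn : 1 ≤ n) (x : Fin n → ℝ) :
    0 ≤ (Matrix.of fun i j : Fin n => sineK (x i) (x j)).det ∧
    (Matrix.of fun i j : Fin n => sineK (x i) (x j)).det ≤ 1 := by
  have h := sineK_posSemidef x
  refine ⟨h.det_nonneg, h.det_le_exp_trace_sub_card.trans_eq ?_⟩
  simp [Matrix.trace, sineK]
end
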